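/- arXiv:2104.04618 — 12 statements merged into one kernel-verified Lean document; each statement's English description precedes it below -/
import Mathlib

section
/- Let λ, c ∈ ℂ. Then λ belongs to the spectrum of the Neumann skeleton operator M if and only if -(λ - 1/2)² belongs to the spectrum of c • P. (Consequently, the spectrum of the high-contrast Neumann system is governed by the quadratic relation -(ρ₊/ρ₋)·μ = (λ - 1/2)² linking its eigenvalues λ to eigenvalues μ of the operator product D⁻V⁺.) -/
/-- The block operator `(v, w) ↦ (s v + Q w, s w - v)` is bijective exactly when its Schur
complement `-s² - Q` is. -/
theorem bijective_block_iff {R X : Type*} [CommRing R] [AddCommGroup X] [Module R X]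
    (Q : X →ₗ[R] X) (s : R) :
    Function.Bijective (fun p : X × X => (s • p.1 + Q p.2, s • p.2 - p.1)) ↔
      Function.Bijective (fun w : X => -s ^ 2 • w - Q w) := by
  have key (v w a b : X) : (s • v + Q w, s • w - v) = (a, b) ↔
      v = s • w - b ∧ -s ^ 2 • w - Q w = -(a + s • b) := by
    rw [Prod.mk.injEq]
    constructor
    · rintro ⟨rfl, rfl⟩
      constructor <;> module
    · rintro ⟨rfl, h⟩
      refine ⟨?_, by module⟩
      rw [← sub_eq_zero] at h ⊢
      rw [← neg_eq_zero, ← h]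
      module
  simp only [Function.bijective_iff_existsUnique]
  constructor
  · intro h y
    obtain ⟨⟨v, w⟩, hvw, huniq⟩ := h (-y, 0)
    refine ⟨w, by simpa using ((key v w (-y) 0).1 hvw).2, fun w' hw' => ?_⟩
    exact congrArg Prod.snd (huniq (s • w', w') ((key _ _ _ _).2 ⟨by simp, by simpa using hw'⟩))
  · rintro h ⟨a, b⟩
    obtain ⟨w, hw, huniq⟩ := h (-(a + s • b))
    refine ⟨(s • w - b, w), (key _ _ _ _).2 ⟨rfl, hw⟩, ?_⟩
    rintro ⟨v', w'⟩ h'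
    obtain ⟨rfl, hw'⟩ := (key v' w' a b).1 h'
    rw [huniq w' hw']

/-- For the Neumann skeleton operator `M` on `X × X`, defined by
`M (v, w) = ((1/2) • v - c • (P w), v + (1/2) • w)`, a complex number `λ` belongs to the
spectrum of `M` if and only if `-(λ - 1/2)²` belongs to the spectrum of `c • P`. -/
theorem neumann_skeleton_spectrum {X : Type*} [NormedAddCommGroup X] [NormedSpace ℂ X]
    [CompleteSpace X] (P : X →L[ℂ] X) (c lam : ℂ)
    (M : (X × X) →L[ℂ] (X × X))
    (hM : ∀ v w : X, M (v, w) = ((1/2 : ℂ) • v - c • P w, v + (1/2 : ℂ) • w)) :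
    lam ∈ spectrum ℂ M ↔ -(lam - 1/2) ^ 2 ∈ spectrum ℂ (c • P) := by
  rw [spectrum.mem_iff, spectrum.mem_iff, not_iff_not,
    ContinuousLinearMap.isUnit_iff_bijective, ContinuousLinearMap.isUnit_iff_bijective]
  convert bijective_block_iff (c • P : X →L[ℂ] X).toLinearMap (lam - 1/2) using 2
  · ext ⟨v, w⟩ : 1
    simp only [sub_apply, Algebra.algebraMap_eq_smul_one,
      smul_apply, one_apply_eq_self, hM,
      ContinuousLinearMap.coe_coe, Prod.smul_mk, Prod.mk_sub_mk, Prod.mk.injEq]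
    constructor <;> module
  · ext w
    simp [Algebra.algebraMap_eq_smul_one]
end

section
/- Suppose λ ∈ ℂ and (v, w) ∈ X × X is a nonzero vector with M (v, w) = λ • (v, w). Then w ≠ 0, v = (λ - 1/2) • w, and c • (P w) = -((λ - 1/2)²) • w. In particular, every eigenvector of the Neumann skeleton operator has its first component determined by its second, and the second component is an eigenvector of c • P with eigenvalue -(λ - 1/2)². -/
/-- If `(v, w)` is a nonzero eigenvector of the Neumann skeleton operator `M`
with eigenvalue `λ`, then `w ≠ 0`, `v = (λ - 1/2) • w`, and `w` is an eigenvector of `c • P`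
with eigenvalue `-(λ - 1/2)²`. -/
theorem neumann_skeleton_eigenvector {X : Type*} [NormedAddCommGroup X] [NormedSpace ℂ X]
    [CompleteSpace X] (P : X →L[ℂ] X) (c lam : ℂ)
    (M : (X × X) →L[ℂ] (X × X))
    (hM : ∀ v w : X, M (v, w) = ((1/2 : ℂ) • v - c • P w, v + (1/2 : ℂ) • w))
    (v w : X) (hvw : (v, w) ≠ (0 : X × X))
    (heig : M (v, w) = lam • (v, w)) :
    w ≠ 0 ∧ v = (lam - 1/2) • w ∧ c • P w = (-((lam - 1/2) ^ 2)) • w := by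
  rw [hM, Prod.smul_mk, Prod.mk.injEq] at heig
  obtain ⟨hfst, hsnd⟩ := heig
  have hv : v = (lam - 1/2) • w := by
    rw [sub_smul]
    exact eq_sub_of_add_eq hsnd
  refine ⟨?_, hv, ?_⟩
  · rintro rfl
    exact hvw (by simp [hv])
  · calc
      c • P w = (1/2 : ℂ) • v - lam • v := by rw [← hfst, sub_sub_cancel]
      _ = (-((lam - 1/2) ^ 2)) • w := by
        rw [← sub_smul, hv, smul_smul]
        congr 1
        ring
end

section
/- For every λ, c ∈ ℂ: there exists a nonzero (v, w) ∈ X × X with M (v, w) = λ • (v, w) if and only if there exists a nonzero w ∈ X with c • (P w) = -((λ - 1/2)²) • w. That is, λ is an eigenvalue of the Neumann skeleton operator exactly when -(λ - 1/2)² is an eigenvalue of c • P. -/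
/-- `λ` is an eigenvalue of the Neumann skeleton operator `M` exactly when
`-(λ - 1/2)²` is an eigenvalue of `c • P`. -/
theorem neumann_skeleton_eigenvalue_iff {X : Type*} [NormedAddCommGroup X] [NormedSpace ℂ X]
    [CompleteSpace X] (P : X →L[ℂ] X) (c lam : ℂ)
    (M : (X × X) →L[ℂ] (X × X))
    (hM : ∀ v w : X, M (v, w) = ((1/2 : ℂ) • v - c • P w, v + (1/2 : ℂ) • w)) :
    (∃ p : X × X, p ≠ 0 ∧ M p = lam • p) ↔
      (∃ w : X, w ≠ 0 ∧ c • P w = (-((lam - 1/2) ^ 2)) • w) := by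
  constructor
  · rintro ⟨⟨v, w⟩, hne, h⟩
    rw [hM, Prod.smul_mk, Prod.mk.injEq] at h
    obtain ⟨h₁, h₂⟩ := h
    have hv : v = (lam - 1/2) • w := by
      linear_combination (norm := module) h₂
    subst hv
    refine ⟨w, ?_, ?_⟩
    · rintro rfl
      simp at hne
    · linear_combination (norm := module) -h₁
  · rintro ⟨w, hw, h⟩
    refine ⟨((lam - 1/2) • w, w), fun h₀ => hw (Prod.mk.inj h₀).2, ?_⟩
    rw [hM, h, Prod.smul_mk, Prod.mk.injEq]
    constructor <;> module
end

section
/- Let λ, c ∈ ℂ. Then λ belongs to the spectrum of the Dirichlet skeleton operator M' if and only if -(λ - 1/2)² belongs to the spectrum of c • Q. (Consequently, the spectrum of the high-contrast Dirichlet system is governed by the quadratic relation -(ρ₋/ρ₊)·μ = (λ - 1/2)² linking its eigenvalues λ to eigenvalues μ of the operator product V⁻D⁺.) -/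
/-- A block operator `T` on `X × X` whose equation `T (v, w) = (f, g)` is equivalent to
`w = a • v - f` together with `S v = -(g + a • f)` is bijective exactly when its Schur
complement `S` is. -/
theorem bijective_iff_bijective_schur_complement {R X : Type*} [Ring R] [AddCommGroup X]
    [Module R X] (T : X × X → X × X) (S : X → X) (a : R)
    (h : ∀ v w f g : X, T (v, w) = (f, g) ↔ w = a • v - f ∧ S v = -(g + a • f)) :
    Function.Bijective T ↔ Function.Bijective S := by
  simp only [Function.bijective_iff_existsUnique]
  constructor
  · intro hT y
    obtain ⟨⟨v, w⟩, hvw, huniq⟩ := hT (0, -y)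
    refine ⟨v, by simpa using ((h v w 0 (-y)).1 hvw).2, fun v' hv' => ?_⟩
    exact congrArg Prod.fst (huniq (v', a • v') ((h _ _ _ _).2 ⟨by simp, by simpa using hv'⟩))
  · rintro hS ⟨f, g⟩
    obtain ⟨v, hv, huniq⟩ := hS (-(g + a • f))
    refine ⟨(v, a • v - f), (h _ _ _ _).2 ⟨rfl, hv⟩, ?_⟩
    rintro ⟨v', w'⟩ hvw
    obtain ⟨rfl, hv'⟩ := (h _ _ _ _).1 hvw
    rw [huniq v' hv']

/-- For the Dirichlet skeleton operator `M'` on `X × X`, defined by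
`M' (v, w) = ((1/2) • v + w, -c • (Q v) + (1/2) • w)`, a complex number `λ` belongs to the
spectrum of `M'` if and only if `-(λ - 1/2)²` belongs to the spectrum of `c • Q`. -/
theorem dirichlet_skeleton_spectrum {X : Type*} [NormedAddCommGroup X] [NormedSpace ℂ X]
    [CompleteSpace X] (Q : X →L[ℂ] X) (c lam : ℂ)
    (M' : (X × X) →L[ℂ] (X × X))
    (hM' : ∀ v w : X, M' (v, w) = ((1/2 : ℂ) • v + w, -c • Q v + (1/2 : ℂ) • w)) :
    lam ∈ spectrum ℂ M' ↔ -(lam - 1/2) ^ 2 ∈ spectrum ℂ (c • Q) := by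
  rw [spectrum.mem_iff, spectrum.mem_iff, not_iff_not, ContinuousLinearMap.isUnit_iff_bijective,
    ContinuousLinearMap.isUnit_iff_bijective]
  refine bijective_iff_bijective_schur_complement _ _ (lam - 1/2) fun v w f g => ?_
  simp only [sub_apply, ContinuousLinearMap.algebraMap_apply,
    smul_apply, hM', Prod.smul_mk, Prod.mk_sub_mk, Prod.mk.injEq]
  constructor
  · rintro ⟨rfl, rfl⟩
    constructor <;> module
  · rintro ⟨rfl, hS⟩
    have hg : g = -((-(lam - 1/2) ^ 2) • v - c • Q v) - (lam - 1/2) • f := by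
      rw [hS]; module
    rw [hg]
    constructor <;> module
end

section
/- Let X be a nontrivial complex Banach space and let r > 0 be a real number. The continuous linear operator M₀ on X × X defined by M₀ (v, w) = ((1/2) • v - (r/4) • w, v + (1/2) • w) has spectrum exactly {1/2 + (i/2)·√r, 1/2 - (i/2)·√r}, where √r denotes the real square root of r and i the imaginary unit. (These are the eigenvalue accumulation points 1/2 ± (i/2)·√(ρ₊/ρ₋) of the high-contrast Neumann formulation with density ratio r = ρ₊/ρ₋.) -/
open Polynomial in
/-- An element of an algebra annihilated by `(X - a) * (X - b)` has spectrum inside `{a, b}`. -/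
theorem spectrum_subset_pair_of_mul_eq_zero {𝕜 A : Type*} [Field 𝕜] [Ring A] [Nontrivial A]
    [Algebra 𝕜 A] {x : A} {a b : 𝕜}
    (h : (x - algebraMap 𝕜 A a) * (x - algebraMap 𝕜 A b) = 0) :
    spectrum 𝕜 x ⊆ {a, b} := by
  intro z hz
  have key := spectrum.subset_polynomial_aeval x ((X - C a) * (X - C b)) ⟨z, hz, rfl⟩
  simpa [h, spectrum.zero_eq, sub_eq_zero] using key

/-- An eigenvalue of a continuous linear endomorphism belongs to its spectrum. -/
theorem ContinuousLinearMap.mem_spectrum_of_apply_eq_smul {𝕜 E : Type*} [NormedField 𝕜]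
    [NormedAddCommGroup E] [NormedSpace 𝕜 E] {T : E →L[𝕜] E} {z : 𝕜} {u : E}
    (hu : u ≠ 0) (h : T u = z • u) : z ∈ spectrum 𝕜 T := by
  rintro ⟨S, hS⟩
  apply hu
  have hz : (S : E →L[𝕜] E) u = 0 := by
    simp [hS, h, Algebra.algebraMap_eq_smul_one]
  calc u = ((↑S⁻¹ : E →L[𝕜] E) * (S : E →L[𝕜] E)) u := by rw [S.inv_mul]; rfl
    _ = (↑S⁻¹ : E →L[𝕜] E) ((S : E →L[𝕜] E) u) := rfl
    _ = 0 := by rw [hz, map_zero]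

/-- For a nontrivial complex Banach space `X` and `r > 0`, the idealized
Neumann skeleton operator `M₀ (v, w) = ((1/2) • v - (r/4) • w, v + (1/2) • w)` on `X × X`
has spectrum exactly `{1/2 + (i/2)·√r, 1/2 - (i/2)·√r}`. -/
theorem neumann_idealized_spectrum {X : Type*} [NormedAddCommGroup X] [NormedSpace ℂ X]
    [CompleteSpace X] [Nontrivial X] (r : ℝ) (hr : 0 < r)
    (M₀ : (X × X) →L[ℂ] (X × X))
    (hM₀ : ∀ v w : X, M₀ (v, w) = ((1/2 : ℂ) • v - ((r : ℂ)/4) • w, v + (1/2 : ℂ) • w)) :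
    spectrum ℂ M₀ =
      {1/2 + (Complex.I/2) * (Real.sqrt r : ℂ), 1/2 - (Complex.I/2) * (Real.sqrt r : ℂ)} := by
  have hs : (Real.sqrt r : ℂ) * (Real.sqrt r : ℂ) = r := by
    exact_mod_cast Real.mul_self_sqrt hr.le
  have hI := Complex.I_mul_I
  generalize (Real.sqrt r : ℂ) = s at hs ⊢
  have eigen : ∀ μ : ℂ, μ * μ = -(r / 4) → 1 / 2 + μ ∈ spectrum ℂ M₀ := by
    intro μ hμ
    obtain ⟨w, hw⟩ := exists_ne (0 : X)
    refine ContinuousLinearMap.mem_spectrum_of_apply_eq_smul (u := (μ • w, w))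
      (fun h => hw (congrArg Prod.snd h)) ?_
    rw [hM₀, Prod.smul_mk, Prod.mk.injEq]
    constructor
    · linear_combination (norm := module) (-hμ) • w
    · module
  apply Set.Subset.antisymm
  · apply spectrum_subset_pair_of_mul_eq_zero
    refine ContinuousLinearMap.ext fun ⟨v, w⟩ => ?_
    simp only [Algebra.algebraMap_eq_smul_one]
    change M₀ (M₀ (v, w) - (1 / 2 - Complex.I / 2 * s) • (v, w)) -
      (1 / 2 + Complex.I / 2 * s) • (M₀ (v, w) - (1 / 2 - Complex.I / 2 * s) • (v, w)) = 0
    simp only [hM₀, Prod.smul_mk, Prod.mk_sub_mk, Prod.mk_eq_zero]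
    constructor
    · linear_combination (norm := module) (-s * s / 4 * hI + hs / 4) • v
    · linear_combination (norm := module) (-s * s / 4 * hI + hs / 4) • w
  · rintro z (rfl | rfl)
    · exact eigen _ (by linear_combination s * s / 4 * hI - hs / 4)
    · rw [sub_eq_add_neg]
      exact eigen _ (by linear_combination s * s / 4 * hI - hs / 4)
end

section
/- Let x, c ∈ ℂ. If x is an accumulation point of the spectrum of the Neumann skeleton operator M (that is, x is a cluster point of (spectrum M) \ {x} in ℂ), then -(x - 1/2)² is an accumulation point of the spectrum of c • P. Hence any accumulation point of the spectrum of the Neumann skeleton is of the form 1/2 ± (i/2)·√(c·μ) with μ an accumulation point of the spectrum of P. -/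
/-- The spectral mapping inclusion for the Neumann skeleton operator: `z ↦ -(z - 1/2)²` maps
the spectrum of `M` into the spectrum of `c • P`. -/
theorem neg_sq_mem_spectrum_of_mem_spectrum_neumann_skeleton {X : Type*} [NormedAddCommGroup X]
    [NormedSpace ℂ X] (P : X →L[ℂ] X) (c z : ℂ) (M : (X × X) →L[ℂ] (X × X))
    (hM : ∀ v w : X, M (v, w) = ((1/2 : ℂ) • v - c • P w, v + (1/2 : ℂ) • w))
    (hz : z ∈ spectrum ℂ M) : -(z - 1/2) ^ 2 ∈ spectrum ℂ (c • P) := by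
  rw [spectrum.mem_iff] at hz ⊢
  contrapose! hz
  obtain ⟨u, hu⟩ := hz
  obtain ⟨s, rfl⟩ : ∃ s : ℂ, z = s + 1/2 := ⟨z - 1/2, by ring⟩
  simp only [add_sub_cancel_right] at hu
  set R : X →L[ℂ] X := ↑u⁻¹
  have hu_apply : ∀ y, (u : X →L[ℂ] X) y = -(s ^ 2) • y - c • P y := by
    intro y
    rw [hu, Algebra.algebraMap_eq_smul_one]
    simp
  have h_right : ∀ y, -(s ^ 2) • R y - c • P (R y) = y := by
    intro y
    rw [← hu_apply]
    exact congrArg (fun T : X →L[ℂ] X => T y) u.mul_inv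
  have h_left : ∀ y, R (-(s ^ 2) • y - c • P y) = y := by
    intro y
    rw [← hu_apply]
    exact congrArg (fun T : X →L[ℂ] X => T y) u.inv_mul
  let W : (X × X) →L[ℂ] X :=
    -(R.comp (ContinuousLinearMap.fst ℂ X X + s • ContinuousLinearMap.snd ℂ X X))
  have hW : ∀ a b, W (a, b) = -R (a + s • b) := fun a b => rfl
  let N : (X × X) →L[ℂ] (X × X) := (s • W - ContinuousLinearMap.snd ℂ X X).prod W
  have hN : ∀ a b, N (a, b) = (s • W (a, b) - b, W (a, b)) := fun a b => rfl
  have hT : ∀ v w, (algebraMap ℂ ((X × X) →L[ℂ] (X × X)) (s + 1/2) - M) (v, w)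
      = (s • v + c • P w, s • w - v) := by
    intro v w
    rw [Algebra.algebraMap_eq_smul_one]
    change (s + 1/2) • (v, w) - M (v, w) = _
    rw [hM]
    ext
    · change (s + 1/2) • v - ((1/2 : ℂ) • v - c • P w) = s • v + c • P w
      module
    · change (s + 1/2) • w - (v + (1/2 : ℂ) • w) = s • w - v
      module
  refine ⟨⟨_, N, ?_, ?_⟩, rfl⟩
  · refine ContinuousLinearMap.ext ?_
    rintro ⟨a, b⟩
    rw [mul_apply_eq_comp, hN, hT, hW, one_apply_eq_self, map_neg]
    have h := h_right (a + s • b)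
    refine Prod.ext ?_ ?_
    · change s • (s • -R (a + s • b) - b) + c • -P (R (a + s • b)) = a
      refine Eq.trans ?_ (sub_eq_of_eq_add h)
      module
    · change s • -R (a + s • b) - (s • -R (a + s • b) - b) = b
      module
  · refine ContinuousLinearMap.ext ?_
    rintro ⟨v, w⟩
    have h : W (s • v + c • P w, s • w - v) = w := by
      rw [hW, ← map_neg]
      convert h_left w using 2
      module
    rw [mul_apply_eq_comp, hT, hN, h, one_apply_eq_self, sub_sub_cancel]

/-- If `x` is an accumulation point of the spectrum of the Neumann skeleton
operator `M` (i.e. a cluster point of `spectrum ℂ M \ {x}`), then `-(x - 1/2)²` is an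
accumulation point of the spectrum of `c • P`. -/
theorem neumann_skeleton_accumulation {X : Type*} [NormedAddCommGroup X] [NormedSpace ℂ X]
    [CompleteSpace X] (P : X →L[ℂ] X) (c x : ℂ)
    (M : (X × X) →L[ℂ] (X × X))
    (hM : ∀ v w : X, M (v, w) = ((1/2 : ℂ) • v - c • P w, v + (1/2 : ℂ) • w))
    (hx : ClusterPt x (Filter.principal (spectrum ℂ M \ {x}))) :
    ClusterPt (-(x - 1/2) ^ 2)
      (Filter.principal (spectrum ℂ (c • P) \ {-(x - 1/2) ^ 2})) := by
  rw [clusterPt_principal_iff_frequently] at hx ⊢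
  have hcont : Filter.Tendsto (fun z : ℂ => -(z - 1/2) ^ 2) (nhds x) (nhds (-(x - 1/2) ^ 2)) :=
    Continuous.tendsto (by fun_prop) x
  have h_inj : ∀ᶠ z in nhds x, z = 1 - x → z = x := by
    by_cases h : x = 1 - x
    · exact Filter.Eventually.of_forall fun z hz => hz.trans h.symm
    · filter_upwards [isOpen_ne.mem_nhds h] with z hz hz'
      exact absurd hz' hz
  refine hcont.frequently ((hx.and_eventually h_inj).mono ?_)
  rintro z ⟨⟨hz, hzx⟩, hz_inj⟩
  refine ⟨neg_sq_mem_spectrum_of_mem_spectrum_neumann_skeleton P c z M hM hz, fun h => hzx ?_⟩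
  rcases sq_eq_sq_iff_eq_or_eq_neg.mp (neg_injective h) with h | h
  · exact sub_left_injective h
  · exact hz_inj (by linear_combination h)
end

section
/- Let x, c ∈ ℂ. If x is an accumulation point of the spectrum of the Dirichlet skeleton operator M' (that is, x is a cluster point of (spectrum M') \ {x} in ℂ), then -(x - 1/2)² is an accumulation point of the spectrum of c • Q. -/
theorem neg_sq_mem_spectrum_of_mem_spectrum_skeleton {X : Type*} [NormedAddCommGroup X]
    [NormedSpace ℂ X] [CompleteSpace X] {Q : X →L[ℂ] X} {c : ℂ} {M' : (X × X) →L[ℂ] (X × X)}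
    (hM' : ∀ v w : X, M' (v, w) = ((1/2 : ℂ) • v + w, -c • Q v + (1/2 : ℂ) • w))
    {y : ℂ} (hy : y ∈ spectrum ℂ M') : -(y - 1/2) ^ 2 ∈ spectrum ℂ (c • Q) := by
  rw [spectrum.mem_iff] at hy ⊢
  contrapose! hy
  rw [ContinuousLinearMap.isUnit_iff_bijective] at hy ⊢
  obtain ⟨hinj, hsurj⟩ := hy
  have hA : ∀ v : X, (algebraMap ℂ (X →L[ℂ] X) (-(y - 1/2) ^ 2) - c • Q) v
      = (-(y - 1/2) ^ 2) • v - c • Q v := fun v => by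
    simp [Algebra.algebraMap_eq_smul_one]
  have hM : ∀ v w : X, (algebraMap ℂ ((X × X) →L[ℂ] (X × X)) y - M') (v, w)
      = ((y - 1/2) • v - w, c • Q v + (y - 1/2) • w) := fun v w => by
    rw [sub_apply, hM', Algebra.algebraMap_eq_smul_one]
    ext
    · simp only [smul_apply, one_apply_eq_self, Prod.fst_sub,
        Prod.smul_fst]
      module
    · simp only [smul_apply, one_apply_eq_self, Prod.snd_sub,
        Prod.smul_snd]
      module
  constructor
  · rw [injective_iff_map_eq_zero] at hinj ⊢
    rintro ⟨v, w⟩ h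
    rw [hM, Prod.mk_eq_zero, sub_eq_zero] at h
    obtain ⟨rfl, h⟩ := h
    have hv : v = 0 := hinj v <| by
      rw [hA, ← neg_eq_zero, ← h]
      module
    simp [hv]
  · rintro ⟨a, b⟩
    obtain ⟨v, hv⟩ := hsurj (-(b + (y - 1/2) • a))
    rw [hA, sub_eq_iff_eq_add'] at hv
    refine ⟨(v, (y - 1/2) • v - a), ?_⟩
    rw [hM]
    ext
    · simp
    · calc c • Q v + (y - 1/2) • ((y - 1/2) • v - a)
          = c • Q v - (-(y - 1/2) ^ 2) • v - (y - 1/2) • a := by module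
        _ = b := by rw [hv]; module

/-- If `x` is an accumulation point of the spectrum of the Dirichlet skeleton
operator `M'` (i.e. a cluster point of `spectrum ℂ M' \ {x}`), then `-(x - 1/2)²` is an
accumulation point of the spectrum of `c • Q`. -/
theorem dirichlet_skeleton_accumulation {X : Type*} [NormedAddCommGroup X] [NormedSpace ℂ X]
    [CompleteSpace X] (Q : X →L[ℂ] X) (c x : ℂ)
    (M' : (X × X) →L[ℂ] (X × X))
    (hM' : ∀ v w : X, M' (v, w) = ((1/2 : ℂ) • v + w, -c • Q v + (1/2 : ℂ) • w))
    (hx : ClusterPt x (Filter.principal (spectrum ℂ M' \ {x}))) :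
    ClusterPt (-(x - 1/2) ^ 2)
      (Filter.principal (spectrum ℂ (c • Q) \ {-(x - 1/2) ^ 2})) := by
  rw [← accPt_principal_iff_clusterPt, accPt_iff_frequently_nhdsNE] at hx ⊢
  have hcont : Filter.Tendsto (fun y : ℂ => -(y - 1/2) ^ 2) (nhdsWithin x {x}ᶜ)
      (nhds (-(x - 1/2) ^ 2)) :=
    (Continuous.tendsto (by fun_prop) x).mono_left nhdsWithin_le_nhds
  have hne : ∀ᶠ y in nhdsWithin x {x}ᶜ, -(y - 1/2) ^ 2 ≠ -(x - 1/2) ^ 2 := by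
    have h1 : ∀ᶠ y in nhdsWithin x {x}ᶜ, y ≠ 1 - x := by
      rcases eq_or_ne x (1 - x) with h | h
      · rw [← h]
        exact self_mem_nhdsWithin
      · exact nhdsWithin_le_nhds (isOpen_ne.mem_nhds h)
    filter_upwards [h1, self_mem_nhdsWithin] with y hy hyx h
    rcases sq_eq_sq_iff_eq_or_eq_neg.mp (neg_injective h) with h | h
    · exact hyx (sub_left_injective h)
    · exact hy (by linear_combination h)
  exact (tendsto_nhdsWithin_iff.mpr ⟨hcont, hne⟩).frequently
    (hx.mono fun y hy => neg_sq_mem_spectrum_of_mem_spectrum_skeleton hM' hy)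
end

section
/- Assume the Calderón identities hold for both signs s ∈ {+, -} and that a·b = 1. Then the square A ∘ A of the PMCHWT operator is the block operator on X × Y with blocks C₁₁ = (1/2) • id_X + K⁺∘K⁻ + K⁻∘K⁺ + b • (V⁺∘D⁻) + a • (V⁻∘D⁺), C₁₂ = a • (V⁻∘T⁺ - K⁺∘V⁻) + (V⁺∘T⁻ - K⁻∘V⁺), C₂₁ = (T⁻∘D⁺ - D⁺∘K⁻) + b • (T⁺∘D⁻ - D⁻∘K⁺), and C₂₂ = (1/2) • id_Y + T⁺∘T⁻ + T⁻∘T⁺ + a • (D⁺∘V⁻) + b • (D⁻∘V⁺); that is, (A ∘ A)(u, v) = (C₁₁ u + C₁₂ v, C₂₁ u + C₂₂ v) for all (u, v) ∈ X × Y. -/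
/-- Under the Calderón identities for both wavenumbers and `a·b = 1`, the
square of the PMCHWT operator is the block operator with blocks
`C₁₁ = (1/2) • id + K⁺K⁻ + K⁻K⁺ + b • V⁺D⁻ + a • V⁻D⁺`,
`C₁₂ = a • (V⁻T⁺ - K⁺V⁻) + (V⁺T⁻ - K⁻V⁺)`,
`C₂₁ = (T⁻D⁺ - D⁺K⁻) + b • (T⁺D⁻ - D⁻K⁺)`,
`C₂₂ = (1/2) • id + T⁺T⁻ + T⁻T⁺ + a • D⁺V⁻ + b • D⁻V⁺`. -/
theorem pmchwt_square_blocks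
    {X Y : Type*} [NormedAddCommGroup X] [NormedSpace ℂ X] [CompleteSpace X]
    [NormedAddCommGroup Y] [NormedSpace ℂ Y] [CompleteSpace Y]
    (Kp Km : X →L[ℂ] X) (Vp Vm : Y →L[ℂ] X) (Dp Dm : X →L[ℂ] Y) (Tp Tm : Y →L[ℂ] Y)
    (a b : ℂ) (hab : a * b = 1)
    (hVDp : Vp.comp Dp = (1/4 : ℂ) • ContinuousLinearMap.id ℂ X - Kp.comp Kp)
    (hVDm : Vm.comp Dm = (1/4 : ℂ) • ContinuousLinearMap.id ℂ X - Km.comp Km)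
    (hDVp : Dp.comp Vp = (1/4 : ℂ) • ContinuousLinearMap.id ℂ Y - Tp.comp Tp)
    (hDVm : Dm.comp Vm = (1/4 : ℂ) • ContinuousLinearMap.id ℂ Y - Tm.comp Tm)
    (hVTp : Vp.comp Tp = Kp.comp Vp)
    (hVTm : Vm.comp Tm = Km.comp Vm)
    (hTDp : Tp.comp Dp = Dp.comp Kp)
    (hTDm : Tm.comp Dm = Dm.comp Km)
    (A : (X × Y) →L[ℂ] (X × Y))
    (hA : ∀ (u : X) (v : Y),
      A (u, v) = (-(Kp u + Km u) + (Vp v + a • Vm v), (Dp u + b • Dm u) + (Tp v + Tm v))) :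
    ∀ (u : X) (v : Y),
      (A.comp A) (u, v) =
        (((1/2 : ℂ) • ContinuousLinearMap.id ℂ X + Kp.comp Km + Km.comp Kp
            + b • (Vp.comp Dm) + a • (Vm.comp Dp)) u
          + (a • (Vm.comp Tp - Kp.comp Vm) + (Vp.comp Tm - Km.comp Vp)) v,
         ((Tm.comp Dp - Dp.comp Km) + b • (Tp.comp Dm - Dm.comp Kp)) u
          + ((1/2 : ℂ) • ContinuousLinearMap.id ℂ Y + Tp.comp Tm + Tm.comp Tp
            + a • (Dp.comp Vm) + b • (Dm.comp Vp)) v) := by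
  intro u v
  have e₁ := DFunLike.congr_fun hVDp u
  have e₂ := DFunLike.congr_fun hVDm u
  have e₃ := DFunLike.congr_fun hDVp v
  have e₄ := DFunLike.congr_fun hDVm v
  have e₅ := DFunLike.congr_fun hVTp v
  have e₆ := DFunLike.congr_fun hVTm v
  have e₇ := DFunLike.congr_fun hTDp u
  have e₈ := DFunLike.congr_fun hTDm u
  simp only [ContinuousLinearMap.comp_apply, sub_apply,
    smul_apply, ContinuousLinearMap.id_apply] at e₁ e₂ e₃ e₄ e₅ e₆ e₇ e₈
  have hab' (x : X) : a • b • x = x := by rw [smul_smul, hab, one_smul]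
  have hba' (y : Y) : b • a • y = y := by rw [smul_smul, mul_comm, hab, one_smul]
  simp only [ContinuousLinearMap.comp_apply, hA, add_apply, sub_apply, smul_apply,
    ContinuousLinearMap.id_apply, map_add, map_neg, map_smul, smul_add, hab', hba',
    e₁, e₂, e₃, e₄, e₅, e₆, e₇, e₈]
  refine Prod.ext ?_ ?_ <;> dsimp only <;> module
end

section
/- Assume the Calderón identities V⁺ ∘ T⁺ = K⁺ ∘ V⁺ and V⁻ ∘ T⁻ = K⁻ ∘ V⁻ hold, and that the differences V⁺ - V⁻, K⁺ - K⁻ and T⁺ - T⁻ are compact operators. Then the off-diagonal block C₁₂ = a • (V⁻∘T⁺ - K⁺∘V⁻) + (V⁺∘T⁻ - K⁻∘V⁺) of the squared PMCHWT operator is a compact operator from Y to X, for every a ∈ ℂ. -/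
/-- If `A` intertwines `T` and `K`, then every compact perturbation `B` of `A` intertwines them
up to a compact operator. -/
theorem isCompactOperator_comp_sub_comp_of_comp_eq
    {X Y : Type*} [NormedAddCommGroup X] [NormedSpace ℂ X]
    [NormedAddCommGroup Y] [NormedSpace ℂ Y]
    {K : X →L[ℂ] X} {A B : Y →L[ℂ] X} {T : Y →L[ℂ] Y}
    (h : A.comp T = K.comp A) (hAB : IsCompactOperator ⇑(A - B)) :
    IsCompactOperator ⇑(B.comp T - K.comp B) := by
  have key : B.comp T - K.comp B = K.comp (A - B) - (A - B).comp T := by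
    rw [ContinuousLinearMap.comp_sub, ContinuousLinearMap.sub_comp, h]
    abel
  rw [key]
  exact (hAB.clm_comp K).sub (hAB.comp_clm T)

/-- Under the Calderón identities `V⁺T⁺ = K⁺V⁺` and `V⁻T⁻ = K⁻V⁻`, and
compactness of `V⁺ - V⁻`, `K⁺ - K⁻` and `T⁺ - T⁻`, the off-diagonal block
`C₁₂ = a • (V⁻T⁺ - K⁺V⁻) + (V⁺T⁻ - K⁻V⁺)` of the squared PMCHWT operator is compact. -/
theorem pmchwt_square_offdiag_C12_compact
    {X Y : Type*} [NormedAddCommGroup X] [NormedSpace ℂ X] [CompleteSpace X]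
    [NormedAddCommGroup Y] [NormedSpace ℂ Y] [CompleteSpace Y]
    (Kp Km : X →L[ℂ] X) (Vp Vm : Y →L[ℂ] X) (Tp Tm : Y →L[ℂ] Y) (a : ℂ)
    (hVTp : Vp.comp Tp = Kp.comp Vp)
    (hVTm : Vm.comp Tm = Km.comp Vm)
    (hV : IsCompactOperator ⇑(Vp - Vm))
    (hK : IsCompactOperator ⇑(Kp - Km))
    (hT : IsCompactOperator ⇑(Tp - Tm)) :
    IsCompactOperator ⇑(a • (Vm.comp Tp - Kp.comp Vm) + (Vp.comp Tm - Km.comp Vp)) := by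
  have hV' : IsCompactOperator ⇑(Vm - Vp) := by
    rw [← neg_sub Vp Vm]
    exact hV.neg
  exact ((isCompactOperator_comp_sub_comp_of_comp_eq hVTp hV).smul a).add
    (isCompactOperator_comp_sub_comp_of_comp_eq hVTm hV')
end

section
/- Assume the Calderón identities T⁺ ∘ D⁺ = D⁺ ∘ K⁺ and T⁻ ∘ D⁻ = D⁻ ∘ K⁻ hold, and that the differences D⁺ - D⁻, K⁺ - K⁻ and T⁺ - T⁻ are compact operators. Then the off-diagonal block C₂₁ = (T⁻∘D⁺ - D⁺∘K⁻) + b • (T⁺∘D⁻ - D⁻∘K⁺) of the squared PMCHWT operator is a compact operator from X to Y, for every b ∈ ℂ. -/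
/-- If `T ∘ D = D ∘ K`, and `T'`, `K'` are compact perturbations of `T`, `K`, then `D` intertwines
`T'` and `K'` up to a compact operator. -/
theorem isCompactOperator_comp_sub_comp_of_comp_eq_comp
    {𝕜 X Y : Type*} [NontriviallyNormedField 𝕜]
    [NormedAddCommGroup X] [NormedSpace 𝕜 X] [NormedAddCommGroup Y] [NormedSpace 𝕜 Y]
    {K K' : X →L[𝕜] X} {D : X →L[𝕜] Y} {T T' : Y →L[𝕜] Y}
    (hTD : T.comp D = D.comp K)
    (hK : IsCompactOperator ⇑(K' - K)) (hT : IsCompactOperator ⇑(T' - T)) :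
    IsCompactOperator ⇑(T'.comp D - D.comp K') := by
  have h : T'.comp D - D.comp K' = (T' - T).comp D - D.comp (K' - K) := by
    rw [ContinuousLinearMap.sub_comp, ContinuousLinearMap.comp_sub, hTD]
    abel
  rw [h]
  exact (hT.comp_clm D).sub (hK.clm_comp D)

/-- Under the Calderón identities `T⁺D⁺ = D⁺K⁺` and `T⁻D⁻ = D⁻K⁻`, and
compactness of `D⁺ - D⁻`, `K⁺ - K⁻` and `T⁺ - T⁻`, the off-diagonal block
`C₂₁ = (T⁻D⁺ - D⁺K⁻) + b • (T⁺D⁻ - D⁻K⁺)` of the squared PMCHWT operator is compact. -/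
theorem pmchwt_square_offdiag_C21_compact
    {X Y : Type*} [NormedAddCommGroup X] [NormedSpace ℂ X] [CompleteSpace X]
    [NormedAddCommGroup Y] [NormedSpace ℂ Y] [CompleteSpace Y]
    (Kp Km : X →L[ℂ] X) (Dp Dm : X →L[ℂ] Y) (Tp Tm : Y →L[ℂ] Y) (b : ℂ)
    (hTDp : Tp.comp Dp = Dp.comp Kp)
    (hTDm : Tm.comp Dm = Dm.comp Km)
    (hD : IsCompactOperator ⇑(Dp - Dm))
    (hK : IsCompactOperator ⇑(Kp - Km))
    (hT : IsCompactOperator ⇑(Tp - Tm)) :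
    IsCompactOperator ⇑((Tm.comp Dp - Dp.comp Km) + b • (Tp.comp Dm - Dm.comp Kp)) := by
  have hK' : IsCompactOperator ⇑(Km - Kp) := by
    rw [← neg_sub]
    exact hK.neg
  have hT' : IsCompactOperator ⇑(Tm - Tp) := by
    rw [← neg_sub]
    exact hT.neg
  exact (isCompactOperator_comp_sub_comp_of_comp_eq_comp hTDp hK' hT').add
    ((isCompactOperator_comp_sub_comp_of_comp_eq_comp hTDm hK hT).smul b)
end

section
/- Assume the Calderón identities V⁺ ∘ D⁺ = (1/4) • id_X - K⁺ ∘ K⁺, V⁻ ∘ D⁻ = (1/4) • id_X - K⁻ ∘ K⁻, D⁺ ∘ V⁺ = (1/4) • id_Y - T⁺ ∘ T⁺ and D⁻ ∘ V⁻ = (1/4) • id_Y - T⁻ ∘ T⁻ hold, that K⁺, K⁻, T⁺, T⁻ are compact operators, that V⁺ - V⁻ and D⁺ - D⁻ are compact operators, and that a·b = 1. Then the diagonal blocks of the squared PMCHWT operator are compact perturbations of scalars: C₁₁ - (1/2 + a/4 + b/4) • id_X is a compact operator on X and C₂₂ - (1/2 + a/4 + b/4) • id_Y is a compact operator on Y,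 where C₁₁ = (K⁺ + K⁻)∘(K⁺ + K⁻) + (V⁺ + a • V⁻)∘(D⁺ + b • D⁻) and C₂₂ = (D⁺ + b • D⁻)∘(V⁺ + a • V⁻) + (T⁺ + T⁻)∘(T⁺ + T⁻). -/
/-- A diagonal block of the squared block operator with diagonal entry `K + L` and off-diagonal
entries `V + a • W` and `D + b • E` is a compact perturbation of a scalar. -/
theorem isCompactOperator_diag_block_sub_smul_id
    {X Y : Type*} [NormedAddCommGroup X] [NormedSpace ℂ X]
    [NormedAddCommGroup Y] [NormedSpace ℂ Y]
    (K L : X →L[ℂ] X) (V W : Y →L[ℂ] X) (D E : X →L[ℂ] Y) (a b : ℂ) (hab : a * b = 1)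
    (hVD : V.comp D = (1/4 : ℂ) • ContinuousLinearMap.id ℂ X - K.comp K)
    (hWE : W.comp E = (1/4 : ℂ) • ContinuousLinearMap.id ℂ X - L.comp L)
    (hK : IsCompactOperator ⇑K) (hL : IsCompactOperator ⇑L)
    (hVW : IsCompactOperator ⇑(V - W)) :
    IsCompactOperator
      ⇑((K + L).comp (K + L) + (V + a • W).comp (D + b • E)
        - (1/2 + a/4 + b/4 : ℂ) • ContinuousLinearMap.id ℂ X) := by
  have key : (K + L).comp (K + L) + (V + a • W).comp (D + b • E)
        - (1/2 + a/4 + b/4 : ℂ) • ContinuousLinearMap.id ℂ X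
      = (K + L).comp (K + L) + (V - W).comp (b • E - a • D)
        - (K.comp ((1 + a) • K) + L.comp ((1 + b) • L)) := by
    ext x
    have hVDx := DFunLike.congr_fun hVD x
    have hWEx := DFunLike.congr_fun hWE x
    simp only [ContinuousLinearMap.comp_apply, add_apply, sub_apply, smul_apply,
      ContinuousLinearMap.id_apply, map_add, map_sub, map_smul] at hVDx hWEx ⊢
    linear_combination (norm := module) (1 + a) • hVDx + (1 + b) • hWEx + hab • W (E x)
  rw [key]
  exact (((hK.add hL).comp_clm (K + L)).add (hVW.comp_clm (b • E - a • D))).sub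
    ((hK.comp_clm ((1 + a) • K)).add (hL.comp_clm ((1 + b) • L)))

/-- Under the Calderón identities for both wavenumbers, compactness of
`K⁺, K⁻, T⁺, T⁻` and of `V⁺ - V⁻`, `D⁺ - D⁻`, and `a·b = 1`, the diagonal blocks
`C₁₁ = (K⁺+K⁻)² + (V⁺ + a•V⁻)(D⁺ + b•D⁻)` and `C₂₂ = (D⁺ + b•D⁻)(V⁺ + a•V⁻) + (T⁺+T⁻)²`
of the squared PMCHWT operator are compact perturbations of `(1/2 + a/4 + b/4) • id`. -/
theorem pmchwt_square_diag_compact_perturbation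
    {X Y : Type*} [NormedAddCommGroup X] [NormedSpace ℂ X] [CompleteSpace X]
    [NormedAddCommGroup Y] [NormedSpace ℂ Y] [CompleteSpace Y]
    (Kp Km : X →L[ℂ] X) (Vp Vm : Y →L[ℂ] X) (Dp Dm : X →L[ℂ] Y) (Tp Tm : Y →L[ℂ] Y)
    (a b : ℂ) (hab : a * b = 1)
    (hVDp : Vp.comp Dp = (1/4 : ℂ) • ContinuousLinearMap.id ℂ X - Kp.comp Kp)
    (hVDm : Vm.comp Dm = (1/4 : ℂ) • ContinuousLinearMap.id ℂ X - Km.comp Km)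
    (hDVp : Dp.comp Vp = (1/4 : ℂ) • ContinuousLinearMap.id ℂ Y - Tp.comp Tp)
    (hDVm : Dm.comp Vm = (1/4 : ℂ) • ContinuousLinearMap.id ℂ Y - Tm.comp Tm)
    (hKp : IsCompactOperator ⇑Kp) (hKm : IsCompactOperator ⇑Km)
    (hTp : IsCompactOperator ⇑Tp) (hTm : IsCompactOperator ⇑Tm)
    (hV : IsCompactOperator ⇑(Vp - Vm))
    (hD : IsCompactOperator ⇑(Dp - Dm)) :
    IsCompactOperator
        ⇑((Kp + Km).comp (Kp + Km) + (Vp + a • Vm).comp (Dp + b • Dm)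
          - (1/2 + a/4 + b/4 : ℂ) • ContinuousLinearMap.id ℂ X) ∧
      IsCompactOperator
        ⇑((Dp + b • Dm).comp (Vp + a • Vm) + (Tp + Tm).comp (Tp + Tm)
          - (1/2 + a/4 + b/4 : ℂ) • ContinuousLinearMap.id ℂ Y) := by
  refine ⟨isCompactOperator_diag_block_sub_smul_id Kp Km Vp Vm Dp Dm a b hab hVDp hVDm hKp hKm hV,
    ?_⟩
  rw [add_comm ((Dp + b • Dm).comp (Vp + a • Vm)), add_right_comm (1/2 : ℂ)]
  exact isCompactOperator_diag_block_sub_smul_id Tp Tm Dp Dm Vp Vm b a ((mul_comm b a).trans hab)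
    hDVp hDVm hTp hTm hD
end

section
/- Assume the Calderón identities hold for both signs s ∈ {+, -}, that K⁺, K⁻, T⁺, T⁻ are compact operators, that V⁺ - V⁻ and D⁺ - D⁻ are compact operators, and that a·b = 1. Then the Calderón preconditioned PMCHWT operator satisfies: A ∘ A - (1/2 + a/4 + b/4) • id_{X × Y} is a compact operator on X × Y. In particular, with a = ρ₋/ρ₊ and b = ρ₊/ρ₋ for positive densities ρ₊, ρ₋, the squared PMCHWT operator is a compact perturbation of the scalar 1/2 + ρ₊/(4ρ₋) + ρ₋/(4ρ₊) times the identity, so its eigenvalues have the single accumulation point 1/2 + ρ₊/(4ρ₋) + ρ₋/(4ρ₊). -/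
section CompactOperator

variable {𝕜 E F : Type*} [NontriviallyNormedField 𝕜]
  [NormedAddCommGroup E] [NormedSpace 𝕜 E] [NormedAddCommGroup F] [NormedSpace 𝕜 F]

theorem IsCompactOperator.prodMk {M M₁ M₂ : Type*} [Zero M] [TopologicalSpace M]
    [TopologicalSpace M₁] [TopologicalSpace M₂] {f : M → M₁} {g : M → M₂}
    (hf : IsCompactOperator f) (hg : IsCompactOperator g) :
    IsCompactOperator fun x => (f x, g x) := by
  obtain ⟨K, hK, hfK⟩ := hf
  obtain ⟨L, hL, hgL⟩ := hg
  refine ⟨K ×ˢ L, hK.prod hL, ?_⟩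
  filter_upwards [hfK, hgL] with x hx hy using ⟨hx, hy⟩

theorem IsCompactOperator.sub_smul_id_of_eq_sub_comp_self {S K : E →L[𝕜] E} {c : 𝕜}
    (hK : IsCompactOperator K) (hS : S = c • ContinuousLinearMap.id 𝕜 E - K.comp K) :
    IsCompactOperator (S - c • ContinuousLinearMap.id 𝕜 E) := by
  rw [hS, sub_sub_cancel_left]
  exact (hK.clm_comp K).neg

/-- If `Vp ∘ Dp` and `Vm ∘ Dm` are compact perturbations of the same scalar `c`, and `Dp - Dm` is
compact, then `(Vp + a • Vm) ∘ (Dp + b • Dm)` is a compact perturbation of a scalar. -/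
theorem isCompactOperator_add_smul_comp_sub_smul_id
    {Vp Vm : F →L[𝕜] E} {Dp Dm : E →L[𝕜] F} {a b c : 𝕜} (hab : a * b = 1)
    (hp : IsCompactOperator (Vp.comp Dp - c • ContinuousLinearMap.id 𝕜 E))
    (hm : IsCompactOperator (Vm.comp Dm - c • ContinuousLinearMap.id 𝕜 E))
    (hD : IsCompactOperator (Dp - Dm)) :
    IsCompactOperator ((Vp + a • Vm).comp (Dp + b • Dm)
      - ((2 + a + b) * c) • ContinuousLinearMap.id 𝕜 E) := by
  have h := (((hp.smul (1 + b)).add (hm.smul (1 + a))).sub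
    ((hD.clm_comp Vp).smul b)).add ((hD.clm_comp Vm).smul a)
  refine (congrArg IsCompactOperator (funext fun x => ?_)).mpr h
  simp only [sub_apply, add_apply,
    smul_apply, ContinuousLinearMap.comp_apply, ContinuousLinearMap.id_apply,
    Pi.add_apply, Pi.sub_apply, Pi.smul_apply, Function.comp_apply, map_add, map_sub, map_smul]
  linear_combination (norm := module) hab • Vm (Dm x)

/-- A block operator on a product is a compact perturbation of `c • id` after squaring, if its
diagonal blocks are compact and the products of its off-diagonal blocks are compact
perturbations of `c • id`. -/
theorem isCompactOperator_block_comp_self_sub_smul_id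
    {P : E →L[𝕜] E} {V : F →L[𝕜] E} {D : E →L[𝕜] F} {T : F →L[𝕜] F} {c : 𝕜}
    {A : (E × F) →L[𝕜] (E × F)} (hA : ∀ u v, A (u, v) = (P u + V v, D u + T v))
    (hP : IsCompactOperator P) (hT : IsCompactOperator T)
    (hVD : IsCompactOperator (V.comp D - c • ContinuousLinearMap.id 𝕜 E))
    (hDV : IsCompactOperator (D.comp V - c • ContinuousLinearMap.id 𝕜 F)) :
    IsCompactOperator (A.comp A - c • ContinuousLinearMap.id 𝕜 (E × F)) := by
  have h₁ := (((hP.clm_comp P).add hVD).comp_clm (.fst 𝕜 E F)).add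
    (((hP.comp_clm V).add (hT.clm_comp V)).comp_clm (.snd 𝕜 E F))
  have h₂ := (((hP.clm_comp D).add (hT.comp_clm D)).comp_clm (.fst 𝕜 E F)).add
    (((hT.clm_comp T).add hDV).comp_clm (.snd 𝕜 E F))
  refine (congrArg IsCompactOperator (funext fun ⟨u, v⟩ => ?_)).mpr (h₁.prodMk h₂)
  ext <;> simp [hA] <;> abel

end CompactOperator

/-- Under the Calderón identities for both wavenumbers, compactness of
`K⁺, K⁻, T⁺, T⁻` and of `V⁺ - V⁻`, `D⁺ - D⁻`, and `a·b = 1`, the squared PMCHWT operator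
is a compact perturbation of the scalar `1/2 + a/4 + b/4` times the identity on `X × Y`. -/
theorem calderon_pmchwt_compact_perturbation
    {X Y : Type*} [NormedAddCommGroup X] [NormedSpace ℂ X] [CompleteSpace X]
    [NormedAddCommGroup Y] [NormedSpace ℂ Y] [CompleteSpace Y]
    (Kp Km : X →L[ℂ] X) (Vp Vm : Y →L[ℂ] X) (Dp Dm : X →L[ℂ] Y) (Tp Tm : Y →L[ℂ] Y)
    (a b : ℂ) (hab : a * b = 1)
    (hVDp : Vp.comp Dp = (1/4 : ℂ) • ContinuousLinearMap.id ℂ X - Kp.comp Kp)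
    (hVDm : Vm.comp Dm = (1/4 : ℂ) • ContinuousLinearMap.id ℂ X - Km.comp Km)
    (hDVp : Dp.comp Vp = (1/4 : ℂ) • ContinuousLinearMap.id ℂ Y - Tp.comp Tp)
    (hDVm : Dm.comp Vm = (1/4 : ℂ) • ContinuousLinearMap.id ℂ Y - Tm.comp Tm)
    (hVTp : Vp.comp Tp = Kp.comp Vp)
    (hVTm : Vm.comp Tm = Km.comp Vm)
    (hTDp : Tp.comp Dp = Dp.comp Kp)
    (hTDm : Tm.comp Dm = Dm.comp Km)
    (hKp : IsCompactOperator ⇑Kp) (hKm : IsCompactOperator ⇑Km)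
    (hTp : IsCompactOperator ⇑Tp) (hTm : IsCompactOperator ⇑Tm)
    (hV : IsCompactOperator ⇑(Vp - Vm))
    (hD : IsCompactOperator ⇑(Dp - Dm))
    (A : (X × Y) →L[ℂ] (X × Y))
    (hA : ∀ (u : X) (v : Y),
      A (u, v) = (-(Kp u + Km u) + (Vp v + a • Vm v), (Dp u + b • Dm u) + (Tp v + Tm v))) :
    IsCompactOperator
      ⇑(A.comp A - (1/2 + a/4 + b/4 : ℂ) • ContinuousLinearMap.id ℂ (X × Y)) := by
  have hVD := isCompactOperator_add_smul_comp_sub_smul_id hab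
    (hKp.sub_smul_id_of_eq_sub_comp_self hVDp) (hKm.sub_smul_id_of_eq_sub_comp_self hVDm) hD
  have hDV := isCompactOperator_add_smul_comp_sub_smul_id ((mul_comm b a).trans hab)
    (hTp.sub_smul_id_of_eq_sub_comp_self hDVp) (hTm.sub_smul_id_of_eq_sub_comp_self hDVm) hV
  have hc : (2 + a + b) * (1/4) = 1/2 + a/4 + b/4 := by ring
  have hc' : (2 + b + a) * (1/4) = 1/2 + a/4 + b/4 := by ring
  rw [hc] at hVD
  rw [hc'] at hDV
  exact isCompactOperator_block_comp_self_sub_smul_id (P := -(Kp + Km)) (T := Tp + Tm)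
    hA (hKp.add hKm).neg (hTp.add hTm) hVD hDV
end
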